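/- Let (X,b,m) be a connected weighted graph satisfying (B) and (M), let D ⊂ X be relatively dense and Ω := X∖D be nonempty. Then the bottom of the spectrum of the Dirichlet Laplacian satisfies λ_Ω ≥ 1/(Inr(Ω)·vol[Inr(Ω)]), where vol[s] := sup_{x∈X} vol(B_s(x)). Equivalently, ‖f‖² ≤ Inr(Ω)·vol[Inr(Ω)]·E(f,f) for every f ∈ ℓ²(X,m) vanishing on D. -/

import Mathlib

/-! Basic notions for a weighted graph `(X, b, m)`:
`b : X × X → [0,∞)` is a symmetric edge weight, `m : X → (0,∞)` a vertex measure.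
Paths, path lengths, the induced path metric `graphDist`, the energy form,
`ℓ²(X,m)`, volumes, inradius and covering radius. -/

variable {X : Type*}

/-- A path in the weighted graph: a nonempty list of vertices with positive
edge weight between consecutive vertices. -/
def IsPath (b : X → X → ℝ) (γ : List X) : Prop :=
  γ ≠ [] ∧ γ.Chain' fun u v => 0 < b u v

/-- A path from `x` to `y`. -/
def IsPathFrom (b : X → X → ℝ) (γ : List X) (x y : X) : Prop :=
  IsPath b γ ∧ γ.head? = some x ∧ γ.getLast? = some y

/-- The length of a path: the sum of the reciprocals of the edge weights
of its edges. -/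
noncomputable def pathLength (b : X → X → ℝ) : List X → ℝ
  | [] => 0
  | [_] => 0
  | u :: v :: rest => 1 / b u v + pathLength b (v :: rest)

/-- The induced path metric: `d(x,y)` is the infimum of the lengths of paths
from `x` to `y`. -/
noncomputable def graphDist (b : X → X → ℝ) (x y : X) : ℝ :=
  sInf {L | ∃ γ, IsPathFrom b γ x y ∧ L = pathLength b γ}

/-- The energy form `E(f,f) = (1/2) ∑_{x,y} b(x,y) (f(x) - f(y))²`. -/
noncomputable def energy (b : X → X → ℝ) (f : X → ℝ) : ℝ :=
  (1 / 2) * ∑' p : X × X, b p.1 p.2 * (f p.1 - f p.2) ^ 2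

/-- The squared norm in `ℓ²(X,m)`. -/
noncomputable def l2norm (m : X → ℝ) (f : X → ℝ) : ℝ := ∑' x, f x ^ 2 * m x

/-- Membership in `ℓ²(X,m)`. -/
def MemL2 (m : X → ℝ) (f : X → ℝ) : Prop := Summable fun x => f x ^ 2 * m x

/-- The volume of a subset `A ⊆ X`: `vol(A) = ∑_{x ∈ A} m(x)`. -/
noncomputable def vol (m : X → ℝ) (A : Set X) : ℝ := ∑' x : A, m (x : X)

/-- The inradius `Inr(Ω) = sup {r > 0 : ∃ x ∈ Ω, U_r(x) ⊆ Ω}`. -/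
noncomputable def inradius (b : X → X → ℝ) (Ω : Set X) : ℝ :=
  sSup {r | 0 < r ∧ ∃ x ∈ Ω, ∀ y, graphDist b x y < r → y ∈ Ω}

/-- The covering radius `Covr(D) = inf {R > 0 : ⋃_{p ∈ D} B_R(p) = X}`. -/
noncomputable def covRad (b : X → X → ℝ) (D : Set X) : ℝ :=
  sInf {R | 0 < R ∧ ∀ x, ∃ p ∈ D, graphDist b p x ≤ R}

/-- `D` is relatively dense iff its covering radius is finite, i.e. some
`R > 0` works. -/
def RelDense (b : X → X → ℝ) (D : Set X) : Prop :=
  {R : ℝ | 0 < R ∧ ∀ x, ∃ p ∈ D, graphDist b p x ≤ R}.Nonempty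

/-- `vol[s] = sup_{x ∈ X} vol(B_s(x))`. -/
noncomputable def supVolBall (b : X → X → ℝ) (m : X → ℝ) (s : ℝ) : ℝ :=
  ⨆ x : X, vol m {y | graphDist b x y ≤ s}


theorem isPathFrom_nil (b : X → X → ℝ) (x y : X) : ¬ IsPathFrom b [] x y := by
  simp [IsPathFrom, IsPath]

theorem isPathFrom_single (b : X → X → ℝ) (u x y : X) :
    IsPathFrom b [u] x y ↔ u = x ∧ u = y := by
  simp [IsPathFrom, IsPath, List.Chain']

theorem isPathFrom_cons (b : X → X → ℝ) (u v : X) (l : List X) (x y : X) :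
    IsPathFrom b (u :: v :: l) x y ↔ u = x ∧ 0 < b u v ∧ IsPathFrom b (v :: l) v y := by
  simp [IsPathFrom, IsPath, List.Chain', List.getLast?_cons_cons]
  tauto

theorem pathLength_nonneg (b : X → X → ℝ) (hb : ∀ x y, 0 ≤ b x y) :
    ∀ γ : List X, 0 ≤ pathLength b γ
  | [] => by simp [pathLength]
  | [_] => by simp [pathLength]
  | u :: v :: l => by
    have := pathLength_nonneg b hb (v :: l)
    have := hb u v
    rw [pathLength]; positivity

theorem path_head (b : X → X → ℝ) {γ : List X} {x y : X} (h : IsPathFrom b γ x y) :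
    ∃ l, γ = x :: l := by
  cases γ with
  | nil => exact absurd h (isPathFrom_nil b x y)
  | cons u l =>
    refine ⟨l, ?_⟩
    have := h.2.1
    simp at this
    rw [this]

theorem path_cons (b : X → X → ℝ) {γ : List X} {u x y : X} (hu : 0 < b u x)
    (h : IsPathFrom b γ x y) :
    IsPathFrom b (u :: γ) u y ∧ pathLength b (u :: γ) = 1 / b u x + pathLength b γ := by
  obtain ⟨l, rfl⟩ := path_head b h
  exact ⟨(isPathFrom_cons _ _ _ _ _ _).2 ⟨rfl, hu, h⟩, rfl⟩

theorem path_snoc (b : X → X → ℝ) {u y : X} (hu : 0 < b y u) :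
    ∀ (γ : List X) (x : X), IsPathFrom b γ x y →
      IsPathFrom b (γ ++ [u]) x u ∧ pathLength b (γ ++ [u]) = pathLength b γ + 1 / b y u
  | [], x, h => absurd h (isPathFrom_nil b _ _)
  | [v], x, h => by
    obtain ⟨rfl, rfl⟩ := (isPathFrom_single _ _ _ _).1 h
    refine ⟨?_, by simp [pathLength]⟩
    exact (isPathFrom_cons _ _ _ _ _ _).2 ⟨rfl, hu, (isPathFrom_single _ _ _ _).2 ⟨rfl, rfl⟩⟩
  | v :: w :: l, x, h => by
    obtain ⟨rfl, hvw, h'⟩ := (isPathFrom_cons _ _ _ _ _ _).1 h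
    obtain ⟨h1, h2⟩ := path_snoc b hu (w :: l) w h'
    refine ⟨(isPathFrom_cons _ _ _ _ _ _).2 ⟨rfl, hvw, h1⟩, ?_⟩
    simp only [List.cons_append, pathLength] at h2 ⊢
    rw [h2]; ring

theorem path_symm (b : X → X → ℝ) (hs : ∀ x y, b x y = b y x) :
    ∀ (γ : List X) (x y : X), IsPathFrom b γ x y →
      ∃ γ', IsPathFrom b γ' y x ∧ pathLength b γ' = pathLength b γ
  | [], x, y, h => absurd h (isPathFrom_nil b _ _)
  | [v], x, y, h => by
    obtain ⟨rfl, rfl⟩ := (isPathFrom_single _ _ _ _).1 h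
    exact ⟨[v], h, rfl⟩
  | v :: w :: l, x, y, h => by
    obtain ⟨rfl, hvw, h'⟩ := (isPathFrom_cons _ _ _ _ _ _).1 h
    obtain ⟨γ', h1, h2⟩ := path_symm b hs (w :: l) w y h'
    obtain ⟨h3, h4⟩ := path_snoc b (u := v) (by rwa [hs]) γ' y h1
    refine ⟨_, h3, ?_⟩
    rw [h4, h2, pathLength, hs w v]; ring

theorem graphDist_symm (b : X → X → ℝ) (hs : ∀ x y, b x y = b y x) (x y : X) :
    graphDist b x y = graphDist b y x := by
  unfold graphDist
  congr 1
  ext L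
  constructor
  · rintro ⟨γ, h, rfl⟩
    obtain ⟨γ', h1, h2⟩ := path_symm b hs γ _ _ h
    exact ⟨γ', h1, h2.symm⟩
  · rintro ⟨γ, h, rfl⟩
    obtain ⟨γ', h1, h2⟩ := path_symm b hs γ _ _ h
    exact ⟨γ', h1, h2.symm⟩

theorem graphDist_le (b : X → X → ℝ) (hb : ∀ x y, 0 ≤ b x y) {γ : List X} {x y : X}
    (h : IsPathFrom b γ x y) : graphDist b x y ≤ pathLength b γ := by
  apply csInf_le
  · refine ⟨0, ?_⟩
    rintro _ ⟨γ, _, rfl⟩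
    exact pathLength_nonneg b hb γ
  · exact ⟨γ, h, rfl⟩

theorem exists_path_lt (b : X → X → ℝ) (hconn : ∀ x y, ∃ γ, IsPathFrom b γ x y) {x y : X}
    {r : ℝ} (h : graphDist b x y < r) : ∃ γ, IsPathFrom b γ x y ∧ pathLength b γ < r := by
  have hne : {L | ∃ γ, IsPathFrom b γ x y ∧ L = pathLength b γ}.Nonempty := by
    obtain ⟨γ, hγ⟩ := hconn x y
    exact ⟨_, γ, hγ, rfl⟩
  obtain ⟨_, ⟨γ, hγ, rfl⟩, hL⟩ := exists_lt_of_csInf_lt hne h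
  exact ⟨γ, hγ, hL⟩

/-- final segments of a path -/
theorem path_suffix (b : X → X → ℝ) (hb : ∀ x y, 0 ≤ b x y) {u y : X} (t : List X) :
    ∀ (s : List X) (x : X), IsPathFrom b (s ++ u :: t) x y →
      IsPathFrom b (u :: t) u y ∧ pathLength b (u :: t) ≤ pathLength b (s ++ u :: t)
  | [], x, h => by
    obtain ⟨l, hl⟩ := path_head b h
    simp at hl
    obtain ⟨rfl, rfl⟩ := hl
    exact ⟨h, le_rfl⟩
  | [v], x, h => by
    obtain ⟨rfl, hvw, h'⟩ := (isPathFrom_cons _ _ _ _ _ _).1 h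
    refine ⟨h', ?_⟩
    simp only [List.cons_append, List.nil_append, pathLength]
    have : 0 < 1 / b v u := by positivity
    linarith
  | v :: w :: l, x, h => by
    obtain ⟨rfl, hvw, h'⟩ := (isPathFrom_cons _ _ _ _ _ _).1 h
    obtain ⟨h1, h2⟩ := path_suffix b hb t (w :: l) w h'
    refine ⟨h1, h2.trans ?_⟩
    simp only [List.cons_append, pathLength]
    have : 0 < 1 / b v w := by positivity
    linarith

theorem exists_nodup (b : X → X → ℝ) (hb : ∀ x y, 0 ≤ b x y) :
    ∀ (γ : List X) (x y : X), IsPathFrom b γ x y →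
      ∃ γ', IsPathFrom b γ' x y ∧ γ'.Nodup ∧ pathLength b γ' ≤ pathLength b γ
  | [], x, y, h => absurd h (isPathFrom_nil b _ _)
  | [v], x, y, h => ⟨[v], h, by simp, le_rfl⟩
  | v :: w :: l, x, y, h => by
    obtain ⟨rfl, hvw, h'⟩ := (isPathFrom_cons _ _ _ _ _ _).1 h
    obtain ⟨γ', h1, h2, h3⟩ := exists_nodup b hb (w :: l) w y h'
    have hpos : 0 < 1 / b v w := by positivity
    by_cases hv : v ∈ γ'
    · obtain ⟨s, t, rfl⟩ := List.append_of_mem hv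
      obtain ⟨h4, h5⟩ := path_suffix b hb t s w h1
      refine ⟨_, h4, (List.nodup_append.1 h2).2.1, ?_⟩
      rw [pathLength]; linarith
    · obtain ⟨h4, h5⟩ := path_cons b hvw h1
      refine ⟨_, h4, List.nodup_cons.2 ⟨hv, h2⟩, ?_⟩
      rw [h5, pathLength]; linarith

theorem graphDist_mem (b : X → X → ℝ) (hb : ∀ x y, 0 ≤ b x y) (u : X) :
    ∀ (γ : List X) (x y : X), IsPathFrom b γ x y → u ∈ γ →
      ∃ γ', IsPathFrom b γ' x u ∧ pathLength b γ' ≤ pathLength b γ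
  | [], x, y, h, _ => absurd h (isPathFrom_nil b _ _)
  | [v], x, y, h, hu => by
    obtain ⟨rfl, rfl⟩ := (isPathFrom_single _ _ _ _).1 h
    simp at hu
    subst hu
    exact ⟨_, h, le_rfl⟩
  | v :: w :: l, x, y, h, hu => by
    obtain ⟨rfl, hvw, h'⟩ := (isPathFrom_cons _ _ _ _ _ _).1 h
    rcases List.mem_cons.1 hu with rfl | hu
    · exact ⟨[u], (isPathFrom_single _ _ _ _).2 ⟨rfl, rfl⟩, pathLength_nonneg b hb _⟩
    · obtain ⟨γ', h1, h2⟩ := graphDist_mem b hb u (w :: l) w y h' hu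
      obtain ⟨h4, h5⟩ := path_cons b hvw h1
      refine ⟨_, h4, ?_⟩
      rw [h5, pathLength]; linarith

open Classical in
/-- edges of a path in both orientations -/
noncomputable def pathEdges : List X → Finset (X × X)
  | [] => ∅
  | [_] => ∅
  | u :: v :: l => insert (u, v) (insert (v, u) (pathEdges (v :: l)))

theorem pathEdges_mem : ∀ (γ : List X) (p : X × X), p ∈ pathEdges γ → p.1 ∈ γ ∧ p.2 ∈ γ
  | [], p, h => by simp [pathEdges] at h
  | [_], p, h => by simp [pathEdges] at h
  | u :: v :: l, p, h => by
    simp only [pathEdges, Finset.mem_insert] at h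
    rcases h with rfl | rfl | h
    · simp
    · simp
    · have := pathEdges_mem (v :: l) p h
      exact ⟨List.mem_cons_of_mem _ this.1, List.mem_cons_of_mem _ this.2⟩

theorem path_ineq (b : X → X → ℝ) (hs : ∀ x y, b x y = b y x) (hb : ∀ x y, 0 ≤ b x y)
    (f : X → ℝ) :
    ∀ (γ : List X) (x y : X), IsPathFrom b γ x y → γ.Nodup →
      (f x - f y) ^ 2 ≤ pathLength b γ *
        ((1 / 2) * ∑ p ∈ pathEdges γ, b p.1 p.2 * (f p.1 - f p.2) ^ 2)
  | [], x, y, h, _ => absurd h (isPathFrom_nil b _ _)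
  | [v], x, y, h, hu => by
    obtain ⟨rfl, rfl⟩ := (isPathFrom_single _ _ _ _).1 h
    simp [pathLength]
  | v :: w :: l, x, y, h, hn => by
    classical
    obtain ⟨rfl, hvw, h'⟩ := (isPathFrom_cons _ _ _ _ _ _).1 h
    obtain ⟨hv, hn'⟩ := List.nodup_cons.1 hn
    have ih := path_ineq b hs hb f (w :: l) w y h' hn'
    have hne : v ≠ w := by rintro rfl; simp at hv
    have h1 : (w, v) ∉ pathEdges (w :: l) := fun h => hv (pathEdges_mem _ _ h).2
    have h2 : (v, w) ∉ insert (w, v) (pathEdges (w :: l)) := by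
      rw [Finset.mem_insert]
      rintro (h | h)
      · exact hne (Prod.ext_iff.1 h).1
      · exact hv (pathEdges_mem _ _ h).1
    have hS : (1 / 2) * ∑ p ∈ pathEdges (v :: w :: l), b p.1 p.2 * (f p.1 - f p.2) ^ 2
        = b v w * (f v - f w) ^ 2 +
          (1 / 2) * ∑ p ∈ pathEdges (w :: l), b p.1 p.2 * (f p.1 - f p.2) ^ 2 := by
      have : pathEdges (v :: w :: l) = insert (v, w) (insert (w, v) (pathEdges (w :: l))) := by
        simp only [pathEdges]
      rw [this, Finset.sum_insert h2, Finset.sum_insert h1]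
      simp only
      rw [hs w v]; ring
    rw [hS, pathLength]
    have hS0 : 0 ≤ (1 / 2) * ∑ p ∈ pathEdges (w :: l), b p.1 p.2 * (f p.1 - f p.2) ^ 2 :=
      mul_nonneg (by norm_num) (Finset.sum_nonneg fun p _ => mul_nonneg (hb _ _) (sq_nonneg _))
    have hL0 := pathLength_nonneg b hb (w :: l)
    generalize (1 / 2) * ∑ p ∈ pathEdges (w :: l), b p.1 p.2 * (f p.1 - f p.2) ^ 2 = S at *
    generalize pathLength b (w :: l) = L at *
    generalize b v w = β at *
    have e1 : (f v - f y) = (f v - f w) + (f w - f y) := by ring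
    rw [e1]
    generalize f v - f w = A at *
    generalize f w - f y = B at *
    have e2 : (1 / β + L) * (β * A ^ 2 + S) = A ^ 2 + (S / β + L * β * A ^ 2) + L * S := by
      field_simp
      ring
    rw [e2]
    have e3 : 2 * A * B ≤ S / β + L * β * A ^ 2 := by
      have hu : 0 ≤ S / β := by positivity
      have hw : 0 ≤ L * β * A ^ 2 := by positivity
      have : (2 * A * B) ^ 2 ≤ (S / β + L * β * A ^ 2) ^ 2 := by
        have e4 : S / β * (L * β * A ^ 2) = L * S * A ^ 2 := by field_simp
        nlinarith [sq_nonneg (S / β - L * β * A ^ 2), mul_le_mul_of_nonneg_right ih (sq_nonneg A)]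
      exact (abs_le_of_sq_le_sq' this (by positivity)).2
    nlinarith

theorem neighbors (b : X → X → ℝ) (hb : ∀ x y, 0 ≤ b x y) (hsum : ∀ x, Summable fun y => b x y)
    (C : ℝ) (hC : ∀ x, ∑' y, b x y ≤ C) (t : ℝ) (ht : 0 < t) :
    ∃ K : ℕ, ∀ x, ∃ N : Finset X, N.card ≤ K ∧ ∀ y, t ≤ b x y → y ∈ N := by
  obtain ⟨K, hK⟩ := exists_nat_ge (C / t)
  refine ⟨K, fun x => ?_⟩
  have hfin : {y | t ≤ b x y}.Finite := by
    have := (hsum x).tendsto_cofinite_zero.eventually (gt_mem_nhds ht)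
    rw [Filter.eventually_cofinite] at this
    simpa using this
  refine ⟨hfin.toFinset, ?_, fun y hy => by simpa using hy⟩
  have h1 : (hfin.toFinset.card : ℝ) * t ≤ C := by
    calc (hfin.toFinset.card : ℝ) * t = ∑ y ∈ hfin.toFinset, t := by simp
      _ ≤ ∑ y ∈ hfin.toFinset, b x y := Finset.sum_le_sum fun y hy => by simpa using hy
      _ ≤ ∑' y, b x y := (hsum x).sum_le_tsum _ fun y _ => hb x y
      _ ≤ C := hC x
  have h2 : (hfin.toFinset.card : ℝ) ≤ K := by
    refine le_trans ?_ hK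
    rwa [le_div_iff₀ ht]
  exact_mod_cast h2

theorem finite_paths (b : X → X → ℝ) (hb : ∀ x y, 0 ≤ b x y)
    (hsum : ∀ x, Summable fun y => b x y)
    (C : ℝ) (hC0 : 0 < C) (hC : ∀ x, ∑' y, b x y ≤ C) (s : ℝ) :
    ∃ K : ℕ, ∀ x, ∃ F : Finset (List X), F.card ≤ K ∧
      ∀ γ y, IsPathFrom b γ x y → pathLength b γ ≤ s → γ ∈ F := by
  classical
  set R : ℝ := max s 1 with hR
  have hR0 : 0 < R := lt_of_lt_of_le one_pos (le_max_right _ _)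
  obtain ⟨K0, hK0⟩ := neighbors b hb hsum C hC (1 / R) (by positivity)
  have hbC : ∀ x y, b x y ≤ C := fun x y =>
    ((hsum x).le_tsum y fun z _ => hb x z).trans (hC x)
  have key : ∀ n : ℕ, ∃ K : ℕ, ∀ x, ∃ F : Finset (List X), F.card ≤ K ∧
      ∀ γ y, IsPathFrom b γ x y → pathLength b γ ≤ R → pathLength b γ < n * (1 / C) → γ ∈ F := by
    intro n
    induction n with
    | zero =>
      refine ⟨0, fun x => ⟨∅, by simp, fun γ y _ _ h => ?_⟩⟩
      have := pathLength_nonneg b hb γ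
      simp at h; linarith
    | succ n ih =>
      obtain ⟨K, hK⟩ := ih
      choose F hF1 hF2 using hK
      choose N hN1 hN2 using hK0
      refine ⟨K0 * K + 1, fun x =>
        ⟨insert [x] ((N x).biUnion fun y => (F y).image (List.cons x)), ?_, ?_⟩⟩
      · refine (Finset.card_insert_le _ _).trans (Nat.add_le_add_right ?_ 1)
        refine (Finset.card_biUnion_le_card_mul _ _ K fun y _ =>
          Finset.card_image_le.trans (hF1 y)).trans ?_
        exact Nat.mul_le_mul_right _ (hN1 x)
      · intro γ y hγ h1 h2
        match γ, hγ, h1, h2 with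
        | [], hγ, _, _ => exact absurd hγ (isPathFrom_nil b _ _)
        | [v], hγ, _, _ =>
          obtain ⟨rfl, rfl⟩ := (isPathFrom_single _ _ _ _).1 hγ
          simp
        | v :: w :: l, hγ, h1, h2 =>
          obtain ⟨rfl, hvw, h'⟩ := (isPathFrom_cons _ _ _ _ _ _).1 hγ
          rw [pathLength] at h1 h2
          have hl := pathLength_nonneg b hb (w :: l)
          have hp : 1 / C ≤ 1 / b v w := one_div_le_one_div_of_le hvw (hbC v w)
          have hp' : 0 < 1 / b v w := by positivity
          refine Finset.mem_insert_of_mem (Finset.mem_biUnion.2 ⟨w, hN2 v w ?_, ?_⟩)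
          · rw [one_div_le hR0 hvw]; linarith
          · refine Finset.mem_image_of_mem _ (hF2 w (w :: l) y h' (by linarith) ?_)
            push_cast at h2
            linarith
  obtain ⟨n, hn⟩ := exists_nat_gt (R * C)
  obtain ⟨K, hK⟩ := key n
  refine ⟨K, fun x => ?_⟩
  obtain ⟨F, h1, h2⟩ := hK x
  refine ⟨F, h1, fun γ y hγ hs => ?_⟩
  have hsR : pathLength b γ ≤ R := hs.trans (le_max_left _ _)
  refine h2 γ y hγ hsR (hsR.trans_lt ?_)
  rw [mul_one_div, lt_div_iff₀ hC0]
  exact hn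

theorem finite_balls (b : X → X → ℝ) (hb : ∀ x y, 0 ≤ b x y)
    (hsum : ∀ x, Summable fun y => b x y) (hconn : ∀ x y, ∃ γ, IsPathFrom b γ x y)
    (C : ℝ) (hC0 : 0 < C) (hC : ∀ x, ∑' y, b x y ≤ C) (s : ℝ) :
    ∃ K : ℕ, ∀ x, ∃ F : Finset X, F.card ≤ K ∧ ∀ y, y ∈ F ↔ graphDist b x y ≤ s := by
  classical
  obtain ⟨K, hK⟩ := finite_paths b hb hsum C hC0 hC (s + 1)
  refine ⟨K, fun x => ?_⟩
  obtain ⟨F, h1, h2⟩ := hK x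
  have hsub : ∀ y, graphDist b x y ≤ s → y ∈ F.image (fun γ => γ.getLast?.getD x) := by
    intro y hy
    obtain ⟨γ, hγ, hL⟩ := exists_path_lt b hconn (r := s + 1) (by linarith : graphDist b x y < s + 1)
    refine Finset.mem_image.2 ⟨γ, h2 γ y hγ hL.le, ?_⟩
    rw [hγ.2.2]; rfl
  refine ⟨(F.image (fun γ => γ.getLast?.getD x)).filter fun y => graphDist b x y ≤ s, ?_, ?_⟩
  · exact (Finset.card_filter_le _ _).trans (Finset.card_image_le.trans h1)
  · intro y
    rw [Finset.mem_filter]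
    exact ⟨fun h => h.2, fun h => ⟨hsub y h, h⟩⟩

theorem summable_energy (b : X → X → ℝ) (m : X → ℝ)
    (hs : ∀ x y, b x y = b y x) (hb : ∀ x y, 0 ≤ b x y)
    (hsum : ∀ x, Summable fun y => b x y) (δ : ℝ) (hδ : ∀ x, ∑' y, b x y ≤ δ * m x)
    (f : X → ℝ) (hf : MemL2 m f) :
    Summable fun p : X × X => b p.1 p.2 * (f p.1 - f p.2) ^ 2 := by
  have h1 : Summable fun p : X × X => b p.1 p.2 * f p.1 ^ 2 := by
    have h0 : (0 : X × X → ℝ) ≤ fun p : X × X => b p.1 p.2 * f p.1 ^ 2 :=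
      fun p => mul_nonneg (hb p.1 p.2) (sq_nonneg (f p.1))
    refine (summable_prod_of_nonneg h0).2 ⟨fun x => (hsum x).mul_right (f x ^ 2), ?_⟩
    refine Summable.of_nonneg_of_le (fun x => tsum_nonneg fun y => mul_nonneg (hb _ _) (sq_nonneg _))
      (fun x => ?_) (hf.mul_left δ)
    simp only
    rw [tsum_mul_right]
    nlinarith [mul_le_mul_of_nonneg_right (hδ x) (sq_nonneg (f x))]
  have h2 : Summable fun p : X × X => b p.1 p.2 * f p.2 ^ 2 := by
    have := (Equiv.prodComm X X).summable_iff.2 h1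
    refine this.congr fun p => ?_
    simp [hs p.2 p.1]
  refine Summable.of_nonneg_of_le (fun p => mul_nonneg (hb _ _) (sq_nonneg _))
    (fun p => ?_) ((h1.add h2).mul_left 2)
  have := mul_nonneg (hb p.1 p.2) (sq_nonneg (f p.1 + f p.2))
  nlinarith

/-- Theorem 3.8. Let `(X,b,m)` be a connected weighted
graph satisfying (B) and (M), `D ⊆ X` relatively dense and `Ω := X∖D`
nonempty. Then `λ_Ω ≥ 1/(Inr(Ω)·vol[Inr(Ω)])` with
`vol[s] = sup_x vol(B_s(x))`; equivalently (this is the form stated here)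
`‖f‖² ≤ Inr(Ω)·vol[Inr(Ω)]·E(f,f)` for every `f ∈ ℓ²(X,m)` vanishing
on `D`. -/
theorem statement_11 {X : Type*} [Countable X] [Nonempty X]
    (b : X → X → ℝ) (m : X → ℝ)
    (hb_symm : ∀ x y, b x y = b y x) (hb_nonneg : ∀ x y, 0 ≤ b x y)
    (hb_diag : ∀ x, b x x = 0) (hb_sum : ∀ x, Summable fun y => b x y)
    (hm_pos : ∀ x, 0 < m x)
    (hconn : ∀ x y, ∃ γ, IsPathFrom b γ x y)
    (hB : BddAbove (Set.range fun x => (∑' y, b x y) / m x))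
    (hM : BddAbove (Set.range m))
    (D : Set X) (hD : RelDense b D) (hΩne : (Dᶜ : Set X).Nonempty) :
    ∀ f : X → ℝ, MemL2 m f → (∀ x ∈ D, f x = 0) →
      l2norm m f ≤ inradius b Dᶜ * supVolBall b m (inradius b Dᶜ) * energy b f := by
  intro f hf hfD
  classical
  obtain ⟨δ0, hδ0⟩ := hB
  obtain ⟨M, hM⟩ := hM
  have hmM : ∀ x, m x ≤ M := fun x => hM ⟨x, rfl⟩
  have hM0 : 0 < M := (hm_pos (Classical.arbitrary X)).trans_le (hmM _)
  set δ := max δ0 1 with hδdef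
  have hδpos : 0 < δ := lt_of_lt_of_le one_pos (le_max_right _ _)
  have hδ : ∀ x, ∑' y, b x y ≤ δ * m x := fun x => by
    have h : (∑' y, b x y) / m x ≤ δ0 := hδ0 ⟨x, rfl⟩
    rw [← div_le_iff₀ (hm_pos x)]
    exact h.trans (le_max_left _ _)
  have hC0 : 0 < δ * M := mul_pos hδpos hM0
  have hC : ∀ x, ∑' y, b x y ≤ δ * M := fun x =>
    (hδ x).trans (mul_le_mul_of_nonneg_left (hmM x) hδpos.le)
  obtain ⟨R, hR0, hR⟩ := hD
  set I := inradius b Dᶜ with hI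
  have hbdd : BddAbove {r | 0 < r ∧ ∃ x ∈ Dᶜ, ∀ y, graphDist b x y < r → y ∈ Dᶜ} := by
    refine ⟨R, ?_⟩
    rintro r ⟨_, x, _, hr⟩
    obtain ⟨p, hp, hd⟩ := hR x
    by_contra! hlt
    refine hr p ?_ hp
    rw [graphDist_symm b hb_symm]
    exact hd.trans_lt hlt
  have hI0 : 0 ≤ I := Real.sSup_nonneg fun r hr => hr.1.le
  -- geodesics
  have hgeo : ∀ x, x ∈ Dᶜ → ∃ γ, ∃ y ∈ D, IsPathFrom b γ x y ∧ γ.Nodup ∧ pathLength b γ ≤ I := by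
    intro x hx
    obtain ⟨K, hK⟩ := finite_paths b hb_nonneg hb_sum _ hC0 hC (I + 1)
    obtain ⟨F, -, hF⟩ := hK x
    have hclose : ∀ r, I < r → ∃ γ, ∃ y ∈ D, IsPathFrom b γ x y ∧ pathLength b γ < r := by
      intro r hr
      have : ¬ ∀ y, graphDist b x y < r → y ∈ Dᶜ := fun h =>
        absurd (le_csSup hbdd ⟨hI0.trans_lt hr, x, hx, h⟩) (not_le.2 hr)
      push Not at this
      obtain ⟨y, hy, hyD⟩ := this
      obtain ⟨γ, h1, h2⟩ := exists_path_lt b hconn hy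
      exact ⟨γ, y, not_not.1 hyD, h1, h2⟩
    set G := F.filter fun γ => ∃ y ∈ D, IsPathFrom b γ x y with hG
    have hGne : G.Nonempty := by
      obtain ⟨γ, y, hy, h1, h2⟩ := hclose (I + 1) (by linarith)
      exact ⟨γ, Finset.mem_filter.2 ⟨hF γ y h1 h2.le, y, hy, h1⟩⟩
    obtain ⟨γ, hγ, hmin⟩ := G.exists_min_image (pathLength b) hGne
    obtain ⟨hγF, y, hy, hγp⟩ := Finset.mem_filter.1 hγ
    have hle : pathLength b γ ≤ I := by
      by_contra! hlt
      obtain ⟨γ', y', hy', h1, h2⟩ := hclose (min (pathLength b γ) (I + 1))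
        (lt_min hlt (by linarith))
      have h3 := hmin γ' (Finset.mem_filter.2
        ⟨hF γ' y' h1 (h2.le.trans (min_le_right _ _)), y', hy', h1⟩)
      exact absurd h3 (not_le.2 (h2.trans_le (min_le_left _ _)))
    obtain ⟨γ', h1, h2, h3⟩ := exists_nodup b hb_nonneg γ x y hγp
    exact ⟨γ', y, hy, h1, h2, h3.trans hle⟩
  set g : X × X → ℝ := fun p => b p.1 p.2 * (f p.1 - f p.2) ^ 2 with hg
  have hg0 : ∀ p, 0 ≤ g p := fun p => mul_nonneg (hb_nonneg _ _) (sq_nonneg _)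
  have hE : ∀ x, ∃ E : Finset (X × X), f x ^ 2 ≤ I * ((1 / 2) * ∑ p ∈ E, g p) ∧
      ∀ p ∈ E, graphDist b p.1 x ≤ I := by
    intro x
    by_cases hx : x ∈ D
    · exact ⟨∅, by simp [hfD x hx], by simp⟩
    · obtain ⟨γ, y, hy, h1, h2, h3⟩ := hgeo x hx
      refine ⟨pathEdges γ, ?_, ?_⟩
      · have h4 := path_ineq b hb_symm hb_nonneg f γ x y h1 h2
        rw [hfD y hy, sub_zero] at h4
        refine h4.trans (mul_le_mul_of_nonneg_right h3 ?_)
        exact mul_nonneg (by norm_num) (Finset.sum_nonneg fun p _ => hg0 p)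
      · intro p hp
        obtain ⟨γ', h4, h5⟩ := graphDist_mem b hb_nonneg p.1 γ x y h1 (pathEdges_mem _ _ hp).1
        rw [graphDist_symm b hb_symm]
        exact (graphDist_le b hb_nonneg h4).trans (h5.trans h3)
  choose E hE1 hE2 using hE
  obtain ⟨K, hK⟩ := finite_balls b hb_nonneg hb_sum hconn _ hC0 hC I
  choose Bl hBl1 hBl2 using hK
  have hvol : ∀ x, vol m {y | graphDist b x y ≤ I} = ∑ y ∈ Bl x, m y := by
    intro x
    have : {y | graphDist b x y ≤ I} = (Bl x : Set X) := by
      ext y; simp [hBl2]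
    rw [this, vol]
    exact Finset.tsum_subtype (Bl x) m
  set V := supVolBall b m I with hV
  have hVle : ∀ x, ∑ y ∈ Bl x, m y ≤ V := by
    intro x
    rw [← hvol x]
    refine le_ciSup (f := fun x : X => vol m {y | graphDist b x y ≤ I}) ⟨K * M, ?_⟩ x
    rintro _ ⟨z, rfl⟩
    simp only
    rw [hvol z]
    calc ∑ y ∈ Bl z, m y ≤ (Bl z).card • M := Finset.sum_le_card_nsmul _ _ _ fun y _ => hmM y
      _ ≤ K * M := by
        rw [nsmul_eq_mul]
        exact mul_le_mul_of_nonneg_right (by exact_mod_cast hBl1 z) hM0.le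
  have hV0 : 0 ≤ V := (Finset.sum_nonneg fun y _ => (hm_pos y).le).trans
    (hVle (Classical.arbitrary X))
  have hgs : Summable g := summable_energy b m hb_symm hb_nonneg hb_sum δ hδ f hf
  refine hf.tsum_le_of_sum_le fun T => ?_
  set P := T.biUnion E with hP
  calc ∑ x ∈ T, f x ^ 2 * m x
      ≤ ∑ x ∈ T, (I * ((1 / 2) * ∑ p ∈ E x, g p)) * m x :=
        Finset.sum_le_sum fun x _ => mul_le_mul_of_nonneg_right (hE1 x) (hm_pos x).le
    _ = I * (1 / 2) * ∑ x ∈ T, ∑ p ∈ P, if p ∈ E x then g p * m x else 0 := by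
        rw [Finset.mul_sum]
        refine Finset.sum_congr rfl fun x hx => ?_
        rw [← Finset.sum_filter]
        have : P.filter (fun p => p ∈ E x) = E x := by
          ext p
          simp only [Finset.mem_filter, hP, Finset.mem_biUnion]
          exact ⟨fun h => h.2, fun h => ⟨⟨x, hx, h⟩, h⟩⟩
        rw [this, ← Finset.sum_mul]
        ring
    _ = I * (1 / 2) * ∑ p ∈ P, g p * ∑ x ∈ T.filter (fun x => p ∈ E x), m x := by
        rw [Finset.sum_comm]
        congr 1
        refine Finset.sum_congr rfl fun p _ => ?_
        rw [← Finset.sum_filter, Finset.mul_sum]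
    _ ≤ I * (1 / 2) * ∑ p ∈ P, g p * V := by
        refine mul_le_mul_of_nonneg_left ?_ (by positivity)
        refine Finset.sum_le_sum fun p _ => mul_le_mul_of_nonneg_left ?_ (hg0 p)
        refine le_trans ?_ (hVle p.1)
        refine Finset.sum_le_sum_of_subset_of_nonneg ?_ fun y _ _ => (hm_pos y).le
        intro x hx
        rw [hBl2]
        exact hE2 x p (Finset.mem_filter.1 hx).2
    _ = I * V * ((1 / 2) * ∑ p ∈ P, g p) := by
        rw [← Finset.sum_mul]; ring
    _ ≤ I * V * energy b f := by
        refine mul_le_mul_of_nonneg_left ?_ (mul_nonneg hI0 hV0)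
        unfold energy
        exact mul_le_mul_of_nonneg_left (hgs.sum_le_tsum _ fun p _ => hg0 p) (by norm_num)
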